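/- Let T be a squarefree semisimple Λ-module with projective cover P, and let C ⊆ JP be a Λ-submodule with dim_K(P/C) = d. Then the module M = P/C has no proper top-stable degeneration if and only if C is invariant under every Λ-endomorphism of P. -/

import Mathlib

open Module

/-- The Jacobson radical `J` of the ring `Λ` (intersection of the maximal left ideals). -/
noncomputable def jacRad (Λ : Type) [Ring Λ] : Ideal Λ := Ideal.jacobson ⊥

/-- The submodule `J • M` of a `Λ`-module `M`. -/
noncomputable def jrad (Λ : Type) [Ring Λ] (M : Type) [AddCommGroup M] [Module Λ M] :
    Submodule Λ M :=
  Submodule.span Λ {x : M | ∃ a ∈ jacRad Λ, ∃ m : M, a • m = x}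

/-- The underlying space of the `d`-dimensional representation `ρ : Λ →ₐ[K] M_d(K)`. -/
def RepSpace (K : Type) [Field K] (d : ℕ) {Λ : Type} [Ring Λ] [Algebra K Λ]
    (ρ : Λ →ₐ[K] Matrix (Fin d) (Fin d) K) : Type := Fin d → K

section RepSpace
variable (K : Type) [Field K] (d : ℕ) {Λ : Type} [Ring Λ] [Algebra K Λ]
  (ρ : Λ →ₐ[K] Matrix (Fin d) (Fin d) K)

instance : AddCommGroup (RepSpace K d ρ) := inferInstanceAs (AddCommGroup (Fin d → K))
instance : Module K (RepSpace K d ρ) := inferInstanceAs (Module K (Fin d → K))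

/-- The `Λ`-module structure on `K^d` induced by the representation `ρ`. -/
noncomputable instance RepSpace.moduleLambda : Module Λ (RepSpace K d ρ) :=
  Module.compHom (Fin d → K)
    ((Matrix.toLinAlgEquiv' :
        Matrix (Fin d) (Fin d) K ≃ₐ[K] Module.End K (Fin d → K)).toAlgHom.toRingHom.comp
      ρ.toRingHom)

instance : IsScalarTower K Λ (RepSpace K d ρ) := by
  constructor
  intro k a v
  show (Matrix.toLinAlgEquiv'.toAlgHom.toRingHom.comp ρ.toRingHom (k • a)) v
      = k • ((Matrix.toLinAlgEquiv'.toAlgHom.toRingHom.comp ρ.toRingHom a) v)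
  have h : (Matrix.toLinAlgEquiv'.toAlgHom.toRingHom.comp ρ.toRingHom (k • a))
      = k • (Matrix.toLinAlgEquiv'.toAlgHom.toRingHom.comp ρ.toRingHom a) := by
    simp [map_smul]
  rw [h]; rfl

end RepSpace

/-- `M_τ` is a degeneration of `M_ρ`: having fixed a `K`-basis `b` of `Λ` (which identifies the
space of `K`-linear maps `Λ → M_d(K)` with an affine space with polynomial coordinate
functions indexed by `ι × Fin d × Fin d`), the point `τ` lies in the Zariski closure (the zero
locus of all polynomials vanishing on the orbit) of the conjugation orbit of `ρ` under
`GL_d(K)`. -/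
def IsDegeneration {K Λ ι : Type} [Field K] [Ring Λ] [Algebra K Λ] [Fintype ι]
    (b : Basis ι K Λ) (d : ℕ) (ρ τ : Λ →ₐ[K] Matrix (Fin d) (Fin d) K) : Prop :=
  ∀ p : MvPolynomial (ι × Fin d × Fin d) K,
    (∀ g : GL (Fin d) K,
      MvPolynomial.eval
        (fun x => ((g : Matrix (Fin d) (Fin d) K) * ρ (b x.1) *
            ((g⁻¹ : GL (Fin d) K) : Matrix (Fin d) (Fin d) K)) x.2.1 x.2.2) p = 0) →
    MvPolynomial.eval (fun x => τ (b x.1) x.2.1 x.2.2) p = 0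


section helpers

variable {Λ : Type} [Ring Λ]

lemma jrad_eq (M : Type) [AddCommGroup M] [Module Λ M] :
    jrad Λ M = Ring.jacobson Λ • (⊤ : Submodule Λ M) := by
  unfold jrad jacRad
  rw [Ideal.jacobson_bot]
  apply le_antisymm
  · rw [Submodule.span_le]
    rintro _ ⟨a, ha, m, rfl⟩
    exact Submodule.smul_mem_smul ha trivial
  · rw [Submodule.smul_le]
    intro a ha m _
    exact Submodule.subset_span ⟨a, ha, m, rfl⟩

lemma jrad_map_surj {M N : Type} [AddCommGroup M] [Module Λ M] [AddCommGroup N] [Module Λ N]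
    (f : M →ₗ[Λ] N) (hf : Function.Surjective f) : (jrad Λ M).map f = jrad Λ N := by
  rw [jrad_eq, jrad_eq, Submodule.map_smul'', Submodule.map_top, LinearMap.range_eq_top.mpr hf]

lemma jrad_map_le {M N : Type} [AddCommGroup M] [Module Λ M] [AddCommGroup N] [Module Λ N]
    (f : M →ₗ[Λ] N) : (jrad Λ M).map f ≤ jrad Λ N := by
  rw [jrad_eq, jrad_eq, Submodule.map_smul'']
  exact Submodule.smul_mono le_rfl le_top

lemma top_equiv {M N : Type} [AddCommGroup M] [Module Λ M] [AddCommGroup N] [Module Λ N]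
    (e : M ≃ₗ[Λ] N) : Nonempty ((M ⧸ jrad Λ M) ≃ₗ[Λ] (N ⧸ jrad Λ N)) :=
  ⟨Submodule.Quotient.equiv _ _ e (jrad_map_surj (e : M →ₗ[Λ] N) e.surjective)⟩

lemma top_quot {P : Type} [AddCommGroup P] [Module Λ P] (C : Submodule Λ P)
    (hC : C ≤ jrad Λ P) : Nonempty (((P ⧸ C) ⧸ jrad Λ (P ⧸ C)) ≃ₗ[Λ] (P ⧸ jrad Λ P)) := by
  rw [← jrad_map_surj C.mkQ C.mkQ_surjective]
  exact ⟨Submodule.quotientQuotientEquivQuotient C (jrad Λ P) hC⟩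

lemma nak {M : Type} [AddCommGroup M] [Module Λ M] [Module.Finite Λ M] (N : Submodule Λ M)
    (h : N ⊔ jrad Λ M = ⊤) : N = ⊤ := by
  rcases eq_top_or_exists_le_coatom N with h1 | ⟨m, hm, hle⟩
  · exact h1
  · exfalso
    have : jrad Λ M ≤ m := by
      rw [jrad_eq]
      refine (Ring.jacobson_smul_top_le Λ M).trans ?_
      exact sInf_le hm
    exact hm.1 (top_le_iff.mp (h ▸ sup_le hle this))

/-- lifting a map to the top gives a surjection -/
lemma cover_lift {P M : Type} [AddCommGroup P] [Module Λ P] [AddCommGroup M] [Module Λ M]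
    [Module.Finite Λ M] [Module.Projective Λ P] (D : Submodule Λ M) (hD : D ≤ jrad Λ M)
    (f : P →ₗ[Λ] (M ⧸ D)) (hf : Function.Surjective f) :
    ∃ h : P →ₗ[Λ] M, D.mkQ ∘ₗ h = f ∧ Function.Surjective h := by
  obtain ⟨h, hh⟩ := Module.projective_lifting_property D.mkQ f D.mkQ_surjective
  refine ⟨h, hh, ?_⟩
  rw [← LinearMap.range_eq_top]
  apply nak
  rw [eq_top_iff]
  intro m _
  obtain ⟨p, hp⟩ := hf (D.mkQ m)
  have : m - h p ∈ D := by
    rw [← Submodule.ker_mkQ D, LinearMap.mem_ker, map_sub, ← hp, ← hh]; simp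
  have e : m = h p + (m - h p) := by abel
  rw [e]
  exact Submodule.add_mem_sup ⟨p, rfl⟩ (hD this)

end helpers

section deg
variable {K Λ ι : Type} [Field K] [Ring Λ] [Algebra K Λ] [Fintype ι]

lemma repSpace_smul (d : ℕ) (ρ : Λ →ₐ[K] Matrix (Fin d) (Fin d) K) (a : Λ)
    (v : RepSpace K d ρ) : a • v = (ρ a).mulVec v := rfl

lemma repSpace_finrank (d : ℕ) (ρ : Λ →ₐ[K] Matrix (Fin d) (Fin d) K) :
    finrank K (RepSpace K d ρ) = d := by
  show finrank K (Fin d → K) = d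
  simp

instance repSpace_fin (d : ℕ) (ρ : Λ →ₐ[K] Matrix (Fin d) (Fin d) K) :
    FiniteDimensional K (RepSpace K d ρ) := inferInstanceAs (FiniteDimensional K (Fin d → K))

lemma ann_iff (d : ℕ) (ρ : Λ →ₐ[K] Matrix (Fin d) (Fin d) K) (a : Λ) :
    (∀ v : RepSpace K d ρ, a • v = 0) ↔ ρ a = 0 := by
  constructor
  · intro h
    apply Matrix.toLin'.injective
    refine LinearMap.ext fun v => ?_
    rw [map_zero, Matrix.toLin'_apply]
    exact h v
  · intro h v
    rw [repSpace_smul, h]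
    exact Matrix.zero_mulVec _

lemma deg_zero (b : Basis ι K Λ) (d : ℕ) (ρ τ : Λ →ₐ[K] Matrix (Fin d) (Fin d) K)
    (h : IsDegeneration b d ρ τ) (a : Λ) (ha : ρ a = 0) : τ a = 0 := by
  ext j k
  have key := h (∑ i, MvPolynomial.C (b.repr a i) * MvPolynomial.X (i, j, k)) ?_
  · simp only [map_sum, map_mul, MvPolynomial.eval_C, MvPolynomial.eval_X] at key
    rw [← b.sum_repr a, map_sum, Matrix.sum_apply]
    simpa using key
  · intro g
    simp only [map_sum, map_mul, MvPolynomial.eval_C, MvPolynomial.eval_X]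
    have : ((g : Matrix (Fin d) (Fin d) K) * ρ a *
            ((g⁻¹ : GL (Fin d) K) : Matrix (Fin d) (Fin d) K)) j k = 0 := by
      rw [ha]; simp
    rw [← b.sum_repr a, map_sum, Finset.mul_sum, Finset.sum_mul, Matrix.sum_apply] at this
    simpa using this

lemma dir2 (b : Basis ι K Λ)
    (P : Type) [AddCommGroup P] [Module Λ P] [Module K P] [IsScalarTower K Λ P]
    [FiniteDimensional K P] (hproj : Module.Projective Λ P)
    (C : Submodule Λ P) (hC : C ≤ jrad Λ P)
    (d : ℕ) (hd : finrank K (P ⧸ C) = d)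
    (hinv : ∀ f : P →ₗ[Λ] P, C.map f ≤ C)
    (ρ τ : Λ →ₐ[K] Matrix (Fin d) (Fin d) K)
    (hρ : Nonempty (RepSpace K d ρ ≃ₗ[Λ] (P ⧸ C)))
    (hdeg : IsDegeneration b d ρ τ)
    (htop : Nonempty ((RepSpace K d τ ⧸ jrad Λ (RepSpace K d τ)) ≃ₗ[Λ]
          (RepSpace K d ρ ⧸ jrad Λ (RepSpace K d ρ)))) :
    Nonempty (RepSpace K d τ ≃ₗ[Λ] RepSpace K d ρ) := by
  obtain ⟨e⟩ := hρ
  obtain ⟨t⟩ := htop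
  obtain ⟨t1⟩ := top_equiv e
  obtain ⟨t2⟩ := top_quot C hC
  have : Module.Finite Λ (RepSpace K d τ) := Module.Finite.of_restrictScalars_finite K Λ _
  obtain ⟨h, -, hs⟩ := cover_lift (jrad Λ (RepSpace K d τ)) le_rfl
    ((t.trans (t1.trans t2)).symm.toLinearMap ∘ₗ (jrad Λ P).mkQ)
    ((t.trans (t1.trans t2)).symm.surjective.comp (jrad Λ P).mkQ_surjective)
  -- homs P → P/C kill C
  have k1 : ∀ u : P →ₗ[Λ] (P ⧸ C), ∀ c ∈ C, u c = 0 := by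
    intro u c hc
    obtain ⟨f, hf⟩ := Module.projective_lifting_property C.mkQ u C.mkQ_surjective
    rw [← hf]
    simpa using hinv f ⟨c, hc, rfl⟩
  obtain ⟨s, hs'⟩ := hproj.out
  have k2 : ∀ c ∈ C, ∀ p : P, τ (s c p) = 0 := by
    intro c hc p
    apply deg_zero b d ρ τ hdeg
    rw [← ann_iff]
    intro v
    apply e.injective
    have := k1 (e.toLinearMap ∘ₗ LinearMap.toSpanSingleton Λ _ v ∘ₗ Finsupp.lapply p ∘ₗ s) c hc
    simpa using this
  have k3 : C ≤ LinearMap.ker h := by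
    intro c hc
    rw [LinearMap.mem_ker, ← hs' c, Finsupp.linearCombination_apply, Finsupp.sum, map_sum]
    apply Finset.sum_eq_zero
    intro p _
    rw [map_smul]
    exact (ann_iff d τ _).mpr (k2 c hc p) _
  have surj : Function.Surjective ((C.liftQ h k3).restrictScalars K) := by
    intro m
    obtain ⟨p, rfl⟩ := hs m
    exact ⟨C.mkQ p, by simp⟩
  have inj := (LinearMap.injective_iff_surjective_of_finrank_eq_finrank
    (f := (C.liftQ h k3).restrictScalars K) (by rw [hd, repSpace_finrank])).mpr surj
  exact ⟨((LinearEquiv.ofBijective (C.liftQ h k3) ⟨inj, surj⟩).symm).trans e.symm⟩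

end deg

section degen
variable {K Λ ι : Type} [Field K] [Ring Λ] [Algebra K Λ] [Fintype ι]

/-- every module of dimension `d` comes from a representation -/
lemma exists_rep (V : Type) [AddCommGroup V] [Module Λ V] [Module K V] [IsScalarTower K Λ V]
    [FiniteDimensional K V] (d : ℕ) (hd : finrank K V = d) :
    ∃ ρ : Λ →ₐ[K] Matrix (Fin d) (Fin d) K, Nonempty (RepSpace K d ρ ≃ₗ[Λ] V) := by
  let e : V ≃ₗ[K] (Fin d → K) := LinearEquiv.ofFinrankEq _ _ (by simp [hd])
  let ρ : Λ →ₐ[K] Matrix (Fin d) (Fin d) K :=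
    ((LinearMap.toMatrixAlgEquiv' : Module.End K (Fin d → K) ≃ₐ[K] _).toAlgHom.comp
      ((e.conjAlgEquiv K).toAlgHom)).comp (Algebra.lsmul K K V)
  have h : ∀ a v, (ρ a).mulVec (e v) = e (a • v) := by
    intro a v
    show Matrix.toLin' (LinearMap.toMatrix' (e.conjAlgEquiv K (Algebra.lsmul K K V a))) (e v) = _
    rw [Matrix.toLin'_toMatrix']
    simp [LinearEquiv.conjAlgEquiv_apply]
  refine ⟨ρ, ⟨LinearEquiv.symm ⟨⟨⟨fun v => (e v : Fin d → K), ?_⟩, ?_⟩, fun v => e.symm v, ?_, ?_⟩⟩⟩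
  · intro x y; exact e.map_add x y
  · intro a v; exact (h a v).symm
  · intro v; exact e.symm_apply_apply v
  · intro v; exact e.apply_symm_apply v

/-- criterion: an affine-linear family of linear operators -/
lemma deg_of_family [Infinite K] (b : Basis ι K Λ) (d : ℕ)
    (ρ τ : Λ →ₐ[K] Matrix (Fin d) (Fin d) K)
    (A : Λ → Matrix (Fin d) (Fin d) K) (S : Set K) (hS : S.Finite)
    (h : ∀ s ∉ S, ∃ g : GL (Fin d) K, ∀ a, (g : Matrix (Fin d) (Fin d) K) * ρ a *
      ((g⁻¹ : GL (Fin d) K) : Matrix (Fin d) (Fin d) K) = τ a - s • A a) :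
    IsDegeneration b d ρ τ := by
  intro p hp
  let φ : ι × Fin d × Fin d → Polynomial K := fun x =>
    Polynomial.C (τ (b x.1) x.2.1 x.2.2) - Polynomial.X * Polynomial.C (A (b x.1) x.2.1 x.2.2)
  let q : Polynomial K := MvPolynomial.aeval φ p
  have hq : ∀ s, q.eval s = MvPolynomial.eval
      (fun x => (τ (b x.1) - s • A (b x.1)) x.2.1 x.2.2) p := by
    intro s
    show Polynomial.evalRingHom s (MvPolynomial.aeval φ p) = _
    rw [MvPolynomial.aeval_def, MvPolynomial.hom_eval₂, MvPolynomial.eval,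
      MvPolynomial.coe_eval₂Hom]
    congr 1
    · ext; simp
    · funext x
      simp [φ]
      ring
  have q0 : q = 0 := by
    apply Polynomial.eq_zero_of_infinite_isRoot
    apply Set.Infinite.mono (s := Sᶜ) _ hS.infinite_compl
    intro s hs
    obtain ⟨g, hg⟩ := h s hs
    show q.eval s = 0
    rw [hq, ← hp g]
    congr
    funext x
    rw [hg]
  have := hq 0
  rw [q0] at this
  simpa using this.symm

lemma deg_of_maps [Infinite K] (b : Basis ι K Λ) (d : ℕ)
    (ρ τ : Λ →ₐ[K] Matrix (Fin d) (Fin d) K) (M V : Type)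
    [AddCommGroup V] [Module Λ V] [Module K V] [IsScalarTower K Λ V]
    [AddCommGroup M] [Module Λ M] [Module K M] [IsScalarTower K Λ M]
    (eM : RepSpace K d ρ ≃ₗ[Λ] M) (eV : RepSpace K d τ ≃ₗ[Λ] V)
    (A : Λ → (V →ₗ[K] V)) (S : Set K) (hS : S.Finite)
    (h : ∀ s ∉ S, ∃ g : M ≃ₗ[K] V, ∀ a m, g (a • m) = a • g m - s • A a (g m)) :
    IsDegeneration b d ρ τ := by
  let e1 : (Fin d → K) ≃ₗ[K] M := (eM.restrictScalars K : RepSpace K d ρ ≃ₗ[K] M)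
  let e2 : (Fin d → K) ≃ₗ[K] V := (eV.restrictScalars K : RepSpace K d τ ≃ₗ[K] V)
  have he1 : ∀ a v, e1 ((ρ a).mulVec v) = a • e1 v := fun a v => eM.map_smul a v
  have he2 : ∀ a v, e2 ((τ a).mulVec v) = a • e2 v := fun a v => eV.map_smul a v
  refine deg_of_family b d ρ τ
    (fun a => LinearMap.toMatrix' (e2.symm.toLinearMap ∘ₗ A a ∘ₗ e2.toLinearMap)) S hS ?_
  intro s hs
  obtain ⟨g, hg⟩ := h s hs
  let G : (Fin d → K) ≃ₗ[K] (Fin d → K) := e1.trans (g.trans e2.symm)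
  let G1 := LinearMap.toMatrix' G.toLinearMap
  let G2 := LinearMap.toMatrix' G.symm.toLinearMap
  have h12 : G1 * G2 = 1 := by
    simp only [G1, G2]; rw [← LinearMap.toMatrix'_comp]; simp
  have h21 : G2 * G1 = 1 := by
    simp only [G1, G2]; rw [← LinearMap.toMatrix'_comp]; simp
  refine ⟨⟨G1, G2, h12, h21⟩, fun a => ?_⟩
  show G1 * ρ a * G2 = _
  have : G1 * ρ a = (τ a - s • LinearMap.toMatrix'
      (e2.symm.toLinearMap ∘ₗ A a ∘ₗ e2.toLinearMap)) * G1 := by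
    apply Matrix.toLin'.injective
    refine LinearMap.ext fun v => ?_
    apply e2.injective
    simp only [G1, Matrix.toLin'_mul, Matrix.toLin'_toMatrix', map_sub, map_smul,
      LinearMap.comp_apply, LinearMap.sub_apply, LinearMap.smul_apply, Matrix.toLin'_apply,
      LinearEquiv.coe_coe, he2, LinearEquiv.apply_symm_apply]
    simp only [G, LinearEquiv.trans_apply, LinearEquiv.apply_symm_apply, he1, hg]
  rw [this, mul_assoc, h12, mul_one]

end degen

section limit
variable {K : Type} [Field K]

lemma lin_dim {P : Type} [AddCommGroup P] [Module K P] [FiniteDimensional K P]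
    (C C1 C0 : Submodule K P) (x : P →ₗ[K] P) (hC1 : ∀ v, v ∈ C1 ↔ v ∈ C ∧ x v ∈ C)
    (hC0 : ∀ v, v ∈ C0 ↔ ∃ u ∈ C1, ∃ c ∈ C, u + x c = v)
    (hx : ∀ c ∈ C, x c ∈ C → x (x c) ∈ C) : finrank K C0 = finrank K C := by
  let f : C →ₗ[K] P ⧸ C1 := C1.mkQ ∘ₗ x ∘ₗ C.subtype
  let f' : C0 →ₗ[K] P ⧸ C1 := C1.mkQ ∘ₗ C0.subtype
  have h1 : C1 ≤ C := fun v hv => ((hC1 v).1 hv).1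
  have h0 : C1 ≤ C0 := fun v hv => (hC0 v).2 ⟨v, hv, 0, C.zero_mem, by simp⟩
  have hr : LinearMap.range f = LinearMap.range f' := by
    apply le_antisymm
    · rintro _ ⟨⟨c, hc⟩, rfl⟩
      exact ⟨⟨x c, (hC0 _).2 ⟨0, C1.zero_mem, c, hc, by simp⟩⟩, rfl⟩
    · rintro _ ⟨⟨v, hv⟩, rfl⟩
      obtain ⟨u, hu, c, hc, rfl⟩ := (hC0 _).1 hv
      refine ⟨⟨c, hc⟩, ?_⟩
      simp only [f, f', LinearMap.comp_apply, Submodule.subtype_apply, map_add]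
      rw [show C1.mkQ u = 0 by simpa using hu, zero_add]
  have hk : LinearMap.ker f = C1.comap C.subtype := by
    ext ⟨c, hc⟩
    simp only [f, LinearMap.mem_ker, LinearMap.comp_apply, Submodule.subtype_apply,
      Submodule.mkQ_apply, Submodule.Quotient.mk_eq_zero, Submodule.mem_comap]
    rw [hC1, hC1]
    exact ⟨fun h => ⟨hc, h.1⟩, fun h => ⟨h.2, hx c hc h.2⟩⟩
  have hk' : LinearMap.ker f' = C1.comap C0.subtype := by
    rw [LinearMap.ker_comp, Submodule.ker_mkQ]
  have r1 := LinearMap.finrank_range_add_finrank_ker f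
  have r2 := LinearMap.finrank_range_add_finrank_ker f'
  rw [hk, LinearEquiv.finrank_eq (Submodule.comapSubtypeEquivOfLe h1)] at r1
  rw [hk', LinearEquiv.finrank_eq (Submodule.comapSubtypeEquivOfLe h0)] at r2
  rw [hr] at r1
  omega

lemma exists_c {P : Type} [AddCommGroup P] [Module K P]
    (C : Submodule K P) (x : P →ₗ[K] P) :
    ∃ c : P →ₗ[K] P, (∀ v, c v ∈ C) ∧ (∀ v ∈ C, c v = 0) ∧
      (∀ u ∈ C, c (x u) - u ∈ C ∧ x (c (x u) - u) ∈ C) ∧ ∀ v, c (x (c v)) = c v := by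
  let f : C →ₗ[K] P ⧸ C := C.mkQ ∘ₗ x ∘ₗ C.subtype
  let fb : (C ⧸ LinearMap.ker f) →ₗ[K] P ⧸ C := (LinearMap.ker f).liftQ f le_rfl
  have hfb : LinearMap.ker fb = ⊥ := Submodule.ker_liftQ_eq_bot _ _ _ le_rfl
  obtain ⟨L, hL⟩ := LinearMap.exists_leftInverse_of_injective fb hfb
  obtain ⟨sec, hsec⟩ := LinearMap.exists_rightInverse_of_surjective (LinearMap.ker f).mkQ
    (Submodule.range_mkQ _)
  have hL' : ∀ u : C, L (C.mkQ (x u)) = (LinearMap.ker f).mkQ u := by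
    intro u
    exact LinearMap.congr_fun hL ((LinearMap.ker f).mkQ u)
  have hsec' : ∀ w, (LinearMap.ker f).mkQ (sec w) = w := fun w => LinearMap.congr_fun hsec w
  refine ⟨C.subtype ∘ₗ sec ∘ₗ L ∘ₗ C.mkQ, fun v => ?_, fun v hv => ?_, fun u hu => ?_, fun v => ?_⟩
  · simp
  · have : C.mkQ v = 0 := by simpa using hv
    simp only [LinearMap.comp_apply, this, map_zero]
  · simp only [LinearMap.comp_apply]
    rw [hL' ⟨u, hu⟩]
    have : (sec ((LinearMap.ker f).mkQ ⟨u, hu⟩) - ⟨u, hu⟩ : C) ∈ LinearMap.ker f := by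
      rw [← Submodule.Quotient.mk_eq_zero, ← Submodule.mkQ_apply, map_sub, hsec', sub_self]
    refine ⟨C.sub_mem (Subtype.mem _) hu, ?_⟩
    exact (Submodule.Quotient.mk_eq_zero _).1 this
  · simp only [LinearMap.comp_apply, Submodule.subtype_apply]
    rw [hL', hsec']

variable {Λ ι : Type} [Ring Λ] [Algebra K Λ] [Fintype ι]

lemma finrank_quot {P : Type} [AddCommGroup P] [Module Λ P] [Module K P] [IsScalarTower K Λ P]
    [FiniteDimensional K P] (C : Submodule Λ P) :
    finrank K (P ⧸ C) + finrank K (C.restrictScalars K) = finrank K P := by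
  rw [← Submodule.finrank_quotient_add_finrank (C.restrictScalars K),
    LinearEquiv.finrank_eq (Submodule.Quotient.restrictScalarsEquiv K C)]

/-- the limit submodule -/
def limC {P : Type} [AddCommGroup P] [Module Λ P] (C : Submodule Λ P) (x : P →ₗ[Λ] P) :
    Submodule Λ P := (C ⊓ C.comap x) ⊔ C.map x

lemma mem_limC {P : Type} [AddCommGroup P] [Module Λ P] (C : Submodule Λ P) (x : P →ₗ[Λ] P)
    (v : P) : v ∈ limC C x ↔ ∃ u ∈ C ⊓ C.comap x, ∃ c ∈ C, u + x c = v := by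
  unfold limC
  rw [Submodule.mem_sup]
  simp

lemma limC_finrank {P : Type} [AddCommGroup P] [Module Λ P] [Module K P] [IsScalarTower K Λ P]
    [FiniteDimensional K P] (C : Submodule Λ P) (x : P →ₗ[Λ] P)
    (hx : ∀ c ∈ C, x c ∈ C → x (x c) ∈ C) :
    finrank K (P ⧸ limC C x) = finrank K (P ⧸ C) := by
  have h1 := finrank_quot (K := K) C
  have h2 := finrank_quot (K := K) (limC C x)
  have := lin_dim (C.restrictScalars K) ((C ⊓ C.comap x).restrictScalars K)
    ((limC C x).restrictScalars K) (x.restrictScalars K) (fun v => Iff.rfl)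
    (fun v => mem_limC C x v) hx
  omega

lemma deg_main [Infinite K] (b : Basis ι K Λ) (d : ℕ)
    (ρ τ : Λ →ₐ[K] Matrix (Fin d) (Fin d) K)
    {P : Type} [AddCommGroup P] [Module Λ P] [Module K P] [IsScalarTower K Λ P]
    [FiniteDimensional K P] (C : Submodule Λ P) (x : P →ₗ[Λ] P)
    (hx : ∀ c ∈ C, x c ∈ C → x (x c) ∈ C)
    (eM : RepSpace K d ρ ≃ₗ[Λ] (P ⧸ C)) (eV : RepSpace K d τ ≃ₗ[Λ] (P ⧸ limC C x)) :
    IsDegeneration b d ρ τ := by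
  obtain ⟨c, c1, c2, c3, c4⟩ := exists_c (C.restrictScalars K) (x.restrictScalars K)
  let q : P →ₗ[K] (P ⧸ limC C x) := (limC C x).mkQ.restrictScalars K
  have hqa : ∀ (a : Λ) v, q (a • v) = a • q v := fun a v => (limC C x).mkQ.map_smul a v
  have hq0 : ∀ v ∈ limC C x, q v = 0 := fun v hv => by simpa [q] using hv
  have hqx : ∀ v ∈ C, q (x v) = 0 := fun v hv =>
    hq0 _ ((mem_limC C x _).2 ⟨0, Submodule.zero_mem _, v, hv, by simp⟩)
  have hq1 : ∀ v ∈ C, x v ∈ C → q v = 0 := fun v hv hv' =>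
    hq0 _ ((mem_limC C x _).2 ⟨v, ⟨hv, hv'⟩, 0, Submodule.zero_mem _, by simp⟩)
  have hqs : Function.Surjective q := (limC C x).mkQ_surjective
  obtain ⟨σ0, hσ0⟩ := LinearMap.exists_rightInverse_of_surjective q (LinearMap.range_eq_top.mpr hqs)
  let xK : P →ₗ[K] P := x.restrictScalars K
  let σ : (P ⧸ limC C x) →ₗ[K] P := σ0 - xK ∘ₗ c ∘ₗ σ0
  have hσ1 : ∀ v, q (σ v) = v := by
    intro v
    have : q (σ0 v) = v := LinearMap.congr_fun hσ0 v
    simp only [σ, LinearMap.sub_apply, LinearMap.comp_apply, map_sub, this]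
    rw [show q (xK (c (σ0 v))) = 0 from hqx _ (c1 _), sub_zero]
  have hσ2 : ∀ v, c (σ v) = 0 := by
    intro v
    simp only [σ, LinearMap.sub_apply, LinearMap.comp_apply, map_sub]
    rw [show c (xK (c (σ0 v))) = c (σ0 v) from c4 _, sub_self]
  let A : Λ → ((P ⧸ limC C x) →ₗ[K] (P ⧸ limC C x)) := fun a =>
    q ∘ₗ c ∘ₗ (Algebra.lsmul K K P a) ∘ₗ σ
  refine deg_of_maps b d ρ τ (P ⧸ C) (P ⧸ limC C x) eM eV A
    {s | Module.End.HasEigenvalue (xK : Module.End K P) (-s)} ?_ ?_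
  · have : {μ | Module.End.HasEigenvalue (xK : Module.End K P) μ}.Finite := by
      exact Module.End.finite_hasEigenvalue _
    exact this.preimage (neg_injective.injOn)
  intro s hs
  let y : P →ₗ[K] P := xK + s • LinearMap.id
  have yinj : Function.Injective y := by
    rw [← LinearMap.ker_eq_bot]
    have h := hs
    simp only [Set.mem_ofPred_eq, Module.End.hasEigenvalue_iff, not_not,
      Module.End.eigenspace_def] at h
    rw [← h]
    congr 1
    ext v
    simp [y]
  have ysurj : Function.Surjective y := LinearMap.injective_iff_surjective.mp yinj
  have hya : ∀ (a : Λ) u, y (a • u) = a • y u := by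
    intro a u
    simp [y, xK, smul_comm a s u]
  let θ : P →ₗ[K] (P ⧸ limC C x) := q - s • (q ∘ₗ c)
  have hθ : ∀ v, θ v = q v - s • q (c v) := fun v => rfl
  have hθσ : ∀ v, θ (σ v) = v := by
    intro v; rw [hθ, hσ2, hσ1]; simp
  let φ : P →ₗ[K] (P ⧸ limC C x) := θ ∘ₗ y
  have hφC : C.restrictScalars K ≤ LinearMap.ker φ := by
    intro u hu
    have e1 : q (c (x u)) = q u := by
      have := hq1 _ (c3 u hu).1 (c3 u hu).2
      rw [map_sub, sub_eq_zero] at this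
      exact this
    have e2 : y u = x u + s • u := rfl
    rw [LinearMap.mem_ker]
    show θ (y u) = 0
    rw [hθ, e2, map_add, map_add, map_smul, map_smul, c2 u hu, hqx u hu, smul_zero, add_zero, e1]
    simp
  have hφs : Function.Surjective φ := by
    intro v
    obtain ⟨u, hu⟩ := ysurj (σ v)
    exact ⟨u, by show θ (y u) = v; rw [hu, hθσ]⟩
  let g0 : (P ⧸ C) →ₗ[K] (P ⧸ limC C x) := ((C.restrictScalars K).liftQ φ hφC) ∘ₗ
    (Submodule.Quotient.restrictScalarsEquiv K C).symm.toLinearMap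
  have hg0 : ∀ u, g0 (C.mkQ u) = φ u := fun u => rfl
  have gs : Function.Surjective g0 := by
    intro v
    obtain ⟨u, rfl⟩ := hφs v
    exact ⟨C.mkQ u, rfl⟩
  have gi : Function.Injective g0 :=
    (LinearMap.injective_iff_surjective_of_finrank_eq_finrank
      (limC_finrank (K := K) C x hx).symm).mpr gs
  refine ⟨LinearEquiv.ofBijective g0 ⟨gi, gs⟩, fun a m => ?_⟩
  obtain ⟨u, rfl⟩ := C.mkQ_surjective m
  show g0 (a • C.mkQ u) = a • g0 (C.mkQ u) - s • A a (g0 (C.mkQ u))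
  rw [← map_smul, hg0, hg0]
  obtain ⟨u', hu'⟩ := ysurj (σ (φ u) - y u)
  have h1 : φ u' = 0 := by
    show θ (y u') = 0
    rw [hu', map_sub, hθσ]; exact sub_self _
  have h2 : u' ∈ C := by
    have : C.mkQ u' = 0 := gi (by rw [hg0, h1, map_zero])
    simpa using this
  have h3 : θ (y (a • u')) = 0 := hφC (C.smul_mem a h2)
  rw [hya, hu', smul_sub, map_sub, sub_eq_zero, hθ, hqa, hσ1, ← hya] at h3
  exact h3.symm

end limit

section squarefree
variable {K Λ : Type} [Field K] [IsAlgClosed K] [Ring Λ] [Algebra K Λ]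
  {T : Type} [AddCommGroup T] [Module Λ T] [Module K T] [IsScalarTower K Λ T]
  [FiniteDimensional K T]

lemma scalar_on_simple
    (hsf : ∀ S S' : Submodule Λ T, IsSimpleModule Λ ↥S → IsSimpleModule Λ ↥S' →
        Nonempty (↥S ≃ₗ[Λ] ↥S') → S = S')
    (S : Submodule Λ T) (hS : IsSimpleModule Λ S) (F : T →ₗ[Λ] T) :
    ∃ μ : K, ∀ t ∈ S, F t = μ • t := by
  rcases LinearMap.injective_or_eq_zero (F ∘ₗ S.subtype) with h | h
  · let e := LinearEquiv.ofInjective (F ∘ₗ S.subtype) h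
    have hr : IsSimpleModule Λ (LinearMap.range (F ∘ₗ S.subtype)) :=
      (LinearEquiv.isSimpleModule_iff e).1 hS
    have hSr := hsf S _ hS hr ⟨e⟩
    have hF : ∀ t ∈ S, F t ∈ S := by
      intro t ht
      have : F t ∈ LinearMap.range (F ∘ₗ S.subtype) := ⟨⟨t, ht⟩, rfl⟩
      rwa [← hSr] at this
    have : Nontrivial S := IsSimpleModule.nontrivial Λ S
    have : FiniteDimensional K S :=
      inferInstanceAs (FiniteDimensional K (S.restrictScalars K))
    obtain ⟨μ, hμ⟩ := Module.End.exists_eigenvalue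
      ((F.restrict hF).restrictScalars K : Module.End K S)
    obtain ⟨v, hv⟩ := hμ.exists_hasEigenvector
    refine ⟨μ, ?_⟩
    have hv1 : F (v : T) = μ • (v : T) := congrArg Subtype.val hv.apply_eq_smul
    rcases LinearMap.injective_or_eq_zero ((F - μ • LinearMap.id) ∘ₗ S.subtype) with h' | h'
    · exfalso
      apply hv.2
      apply h'
      simp [hv1]
    · intro t ht
      have := LinearMap.congr_fun h' ⟨t, ht⟩
      simpa [sub_eq_zero] using this
  · refine ⟨0, fun t ht => ?_⟩
    rw [zero_smul]
    exact LinearMap.congr_fun h ⟨t, ht⟩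

end squarefree

lemma comm_T (K : Type) {Λ : Type} [Field K] [IsAlgClosed K] [Ring Λ] [Algebra K Λ]
    {T : Type} [AddCommGroup T] [Module Λ T] [Module K T] [IsScalarTower K Λ T]
    [FiniteDimensional K T] (hss : IsSemisimpleModule Λ T)
    (hsf : ∀ S S' : Submodule Λ T, IsSimpleModule Λ ↥S → IsSimpleModule Λ ↥S' →
        Nonempty (↥S ≃ₗ[Λ] ↥S') → S = S')
    (F G : T →ₗ[Λ] T) (t : T) : F (G t) = G (F t) := by
  have key : LinearMap.ker (F ∘ₗ G - G ∘ₗ F) = ⊤ := by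
    rw [eq_top_iff, ← IsSemisimpleModule.sSup_simples_eq_top Λ T]
    apply sSup_le
    intro S hS
    obtain ⟨μ, hμ⟩ := scalar_on_simple (K := K) hsf S hS F
    obtain ⟨ν, hν⟩ := scalar_on_simple (K := K) hsf S hS G
    intro t ht
    simp [hμ t ht, hν t ht, LinearMap.map_smul_of_tower, smul_comm μ ν, sub_eq_zero]
  have : t ∈ LinearMap.ker (F ∘ₗ G - G ∘ₗ F) := key ▸ trivial
  simpa [sub_eq_zero] using this

section ideals
variable {K A : Type} [Field K] [IsAlgClosed K] [Ring A] [Algebra K A] [FiniteDimensional K A]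

/-- two-sided ideals as subspaces -/
def IsTS (I : Submodule K A) : Prop := ∀ a : A, ∀ s ∈ I, a * s ∈ I ∧ s * a ∈ I

lemma eig (I S : Submodule K A) (h : I < S) (f : A →ₗ[K] A)
    (hS : ∀ s ∈ S, f s ∈ S)
    (hI : ∀ s ∈ I, f s ∈ I) : ∃ μ : K, ∃ s ∈ S, s ∉ I ∧ f s - μ • s ∈ I := by
  let I' : Submodule K S := I.comap S.subtype
  have hI' : I' ≤ I'.comap (f.restrict hS) := fun s hs => hI _ hs
  have : Nontrivial (S ⧸ I') := by
    rw [Submodule.Quotient.nontrivial_iff]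
    intro ht
    apply h.2
    intro s hs
    have : (⟨s, hs⟩ : S) ∈ I' := ht ▸ trivial
    exact this
  obtain ⟨μ, hμ⟩ := Module.End.exists_eigenvalue (I'.mapQ I' (f.restrict hS) hI' : Module.End K _)
  obtain ⟨v, hv⟩ := hμ.exists_hasEigenvector
  obtain ⟨s, rfl⟩ := I'.mkQ_surjective v
  refine ⟨μ, s, s.2, fun hs => hv.2 ((Submodule.Quotient.mk_eq_zero I').2 hs), ?_⟩
  have h1 : I'.mkQ (f.restrict hS s - μ • s) = 0 := by
    rw [map_sub, map_smul, sub_eq_zero]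
    exact hv.apply_eq_smul
  exact (Submodule.Quotient.mk_eq_zero I').1 h1

lemma scal (I S : Submodule K A) (hIT : IsTS I) (hST : IsTS S) (h : I < S)
    (hmin : ∀ S' : Submodule K A, IsTS S' → I ≤ S' → S' ≤ S → S' = I ∨ S' = S)
    (f : A →ₗ[K] A) (hS : ∀ s ∈ S, f s ∈ S) (hI : ∀ s ∈ I, f s ∈ I)
    (h1 : ∀ b, ∀ s ∈ S, f (b * s) - b * f s ∈ I)
    (h2 : ∀ b, ∀ s ∈ S, f (s * b) - f s * b ∈ I) :
    ∃ μ : K, ∀ s ∈ S, f s - μ • s ∈ I := by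
  obtain ⟨μ, s0, hs0, hs1, hs2⟩ := eig I S h f hS hI
  refine ⟨μ, ?_⟩
  let S' : Submodule K A := S ⊓ I.comap (f - μ • LinearMap.id)
  have mem : ∀ s, s ∈ S' ↔ s ∈ S ∧ f s - μ • s ∈ I := fun s => Iff.rfl
  have hS' : IsTS S' := by
    intro b s hs
    rw [mem] at hs
    rw [mem, mem]
    refine ⟨⟨(hST b s hs.1).1, ?_⟩, (hST b s hs.1).2, ?_⟩
    · have := I.add_mem (h1 b s hs.1) (hIT b _ hs.2).1
      convert this using 1
      rw [mul_sub, mul_smul_comm]; abel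
    · have := I.add_mem (h2 b s hs.1) (hIT b _ hs.2).2
      convert this using 1
      rw [sub_mul, smul_mul_assoc]; abel
  rcases hmin S' hS' (fun s hs => (mem s).2 ⟨h.1 hs, I.sub_mem (hI s hs) (I.smul_mem _ hs)⟩)
    inf_le_left with e | e
  · exfalso
    exact hs1 (e ▸ (mem s0).2 ⟨hs0, hs2⟩)
  · intro s hs
    rw [← e] at hs
    exact hs.2

lemma exists_step (F : ℕ → Set A) (F0 : ∀ a, a ∈ F 0) (m : ℕ) (Fm : ∀ a ∈ F m, a = 0)
    (Fl : ∀ k, ∀ n ∈ F 1, ∀ s ∈ F k, n * s ∈ F (k + 1))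
    (Fr : ∀ k, ∀ n ∈ F 1, ∀ s ∈ F k, s * n ∈ F (k + 1))
    (Fc : ∀ a b : A, a * b - b * a ∈ F 1)
    (Fa : ∀ a, ∀ n ∈ F 1, a * n ∈ F 1 ∧ n * a ∈ F 1)
    (I : Submodule K A) (hIT : IsTS I) (hne : I ≠ ⊤) :
    ∃ x, x ∉ I ∧ ∀ a, (∃ μ : K, a * x - μ • x ∈ I) ∧ ∃ μ : K, x * a - μ • x ∈ I := by
  obtain ⟨S, ⟨hST, hIS⟩, hmin'⟩ := WellFounded.has_min
    (wellFounded_lt (α := Submodule K A)) {S | IsTS S ∧ I < S}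
    ⟨⊤, fun a s _ => ⟨trivial, trivial⟩, lt_top_iff_ne_top.mpr hne⟩
  have hmin : ∀ S' : Submodule K A, IsTS S' → I ≤ S' → S' ≤ S → S' = I ∨ S' = S := by
    intro S' h1 h2 h3
    rcases h2.eq_or_lt with e | e
    · exact Or.inl e.symm
    · rcases h3.eq_or_lt with e' | e'
      · exact Or.inr e'
      · exact absurd e' (hmin' S' ⟨h1, e⟩)
  have descend : ∀ Q : A → Prop, (∀ k, (∀ s ∈ S, s ∈ F (k+1) → s ∈ I) → ∀ s ∈ S, s ∈ F k → Q s) →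
      ¬ (∀ s ∈ S, Q s → s ∈ I) := by
    intro Q hQ hc
    have : ∀ j, ∀ k, k + j = m → ∀ s ∈ S, s ∈ F k → s ∈ I := by
      intro j
      induction j with
      | zero =>
        intro k hk s _ hsk
        have : k = m := by omega
        rw [Fm s (this ▸ hsk)]; exact I.zero_mem
      | succ j ih =>
        intro k hk s hs hsk
        exact hc s hs (hQ k (ih (k+1) (by omega)) s hs hsk)
    exact hIS.2 (fun s hs => this m 0 (by omega) s hs (F0 s))
  have nl : ∀ s ∈ S, ∀ n ∈ F 1, n * s ∈ I := by
    let S' : Submodule K A :=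
      { carrier := {s | s ∈ S ∧ ∀ n ∈ F 1, n * s ∈ I}
        add_mem' := fun {u v} hu hv => ⟨S.add_mem hu.1 hv.1, fun n hn => by
          rw [mul_add]; exact I.add_mem (hu.2 n hn) (hv.2 n hn)⟩
        zero_mem' := ⟨S.zero_mem, fun n _ => by rw [mul_zero]; exact I.zero_mem⟩
        smul_mem' := fun c u hu => ⟨S.smul_mem c hu.1, fun n hn => by
          rw [mul_smul_comm]; exact I.smul_mem c (hu.2 n hn)⟩ }
    rcases hmin S' (fun b s hs => ⟨⟨(hST b s hs.1).1, fun n hn => by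
        rw [← mul_assoc]; exact hs.2 _ (Fa b n hn).2⟩, (hST b s hs.1).2, fun n hn => by
        rw [← mul_assoc]; exact (hIT b _ (hs.2 n hn)).2⟩)
      (fun s hs => ⟨hIS.1 hs, fun n _ => (hIT n s hs).1⟩) (fun s hs => hs.1) with e | e
    · exfalso
      apply descend (fun s => ∀ n ∈ F 1, n * s ∈ I)
      · intro k hk s hs hsk n hn
        exact hk _ (hST n s hs).1 (Fl k n hn s hsk)
      · intro s hs hq
        have : s ∈ S' := ⟨hs, hq⟩
        rwa [e] at this
    · intro s hs
      rw [← e] at hs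
      exact hs.2
  have nr : ∀ s ∈ S, ∀ n ∈ F 1, s * n ∈ I := by
    let S' : Submodule K A :=
      { carrier := {s | s ∈ S ∧ ∀ n ∈ F 1, s * n ∈ I}
        add_mem' := fun {u v} hu hv => ⟨S.add_mem hu.1 hv.1, fun n hn => by
          rw [add_mul]; exact I.add_mem (hu.2 n hn) (hv.2 n hn)⟩
        zero_mem' := ⟨S.zero_mem, fun n _ => by rw [zero_mul]; exact I.zero_mem⟩
        smul_mem' := fun c u hu => ⟨S.smul_mem c hu.1, fun n hn => by
          rw [smul_mul_assoc]; exact I.smul_mem c (hu.2 n hn)⟩ }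
    rcases hmin S' (fun b s hs => ⟨⟨(hST b s hs.1).1, fun n hn => by
        rw [mul_assoc]; exact (hIT b _ (hs.2 n hn)).1⟩, (hST b s hs.1).2, fun n hn => by
        rw [mul_assoc]; exact hs.2 _ (Fa b n hn).1⟩)
      (fun s hs => ⟨hIS.1 hs, fun n _ => (hIT n s hs).2⟩) (fun s hs => hs.1) with e | e
    · exfalso
      apply descend (fun s => ∀ n ∈ F 1, s * n ∈ I)
      · intro k hk s hs hsk n hn
        exact hk _ (hST n s hs).2 (Fr k n hn s hsk)
      · intro s hs hq
        have : s ∈ S' := ⟨hs, hq⟩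
        rwa [e] at this
    · intro s hs
      rw [← e] at hs
      exact hs.2
  obtain ⟨x, hxS, hxI⟩ := Set.exists_of_ssubset hIS
  refine ⟨x, hxI, fun a => ⟨?_, ?_⟩⟩
  · obtain ⟨μ, hμ⟩ := scal I S hIT hST hIS hmin (LinearMap.mulLeft K a)
      (fun s hs => (hST a s hs).1) (fun s hs => (hIT a s hs).1)
      (fun b s hs => by
        have := nl s hs _ (Fc a b)
        rwa [sub_mul, mul_assoc, mul_assoc] at this)
      (fun b s hs => by simp [mul_assoc])
    exact ⟨μ, hμ x hxS⟩
  · obtain ⟨μ, hμ⟩ := scal I S hIT hST hIS hmin (LinearMap.mulRight K a)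
      (fun s hs => (hST a s hs).2) (fun s hs => (hIT a s hs).2)
      (fun b s hs => by simp [mul_assoc])
      (fun b s hs => by
        have := nr s hs _ (Fc b a)
        rwa [mul_sub, ← mul_assoc, ← mul_assoc] at this)
    exact ⟨μ, hμ x hxS⟩

end ideals

lemma idl0 {R : Type} [Ring R] (J : Ideal R) : J ^ 0 = ⊤ := by
    rw [← Ideal.one_eq_top]; exact Submodule.pow_zero J
lemma idl1 {R : Type} [Ring R] (J : Ideal R) : J ^ 1 = J := Submodule.pow_one J
lemma idls {R : Type} [Ring R] (J : Ideal R) (k : ℕ) : J ^ k * J = J ^ (k + 1) :=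
  (Submodule.pow_succ J).symm
lemma idls' {R : Type} [Ring R] (J : Ideal R) (hJ : J.IsTwoSided) (k : ℕ) :
    J * J ^ k = J ^ (k + 1) := by
  rcases Nat.eq_zero_or_pos k with rfl | h
  · rw [idl1, idl0]; exact Ideal.mul_top J
  · exact (Submodule.pow_succ' J h.ne').symm

set_option maxHeartbeats 1000000 in
lemma dir1 {K Λ ι : Type} [Field K] [IsAlgClosed K] [Ring Λ] [Algebra K Λ]
    [FiniteDimensional K Λ] [Fintype ι] (b : Basis ι K Λ)
    (T : Type) [AddCommGroup T] [Module Λ T] [Module K T] [IsScalarTower K Λ T]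
    [FiniteDimensional K T]
    (P : Type) [AddCommGroup P] [Module Λ P] [Module K P] [IsScalarTower K Λ P]
    [FiniteDimensional K P]
    (hss : IsSemisimpleModule Λ T)
    (hsf : ∀ S S' : Submodule Λ T, IsSimpleModule Λ ↥S → IsSimpleModule Λ ↥S' →
        Nonempty (↥S ≃ₗ[Λ] ↥S') → S = S')
    (hproj : Module.Projective Λ P)
    (hcover : Nonempty ((P ⧸ jrad Λ P) ≃ₗ[Λ] T))
    (C : Submodule Λ P) (hC : C ≤ jrad Λ P)
    (d : ℕ) (hd : finrank K (P ⧸ C) = d)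
    (H : ∀ ρ τ : Λ →ₐ[K] Matrix (Fin d) (Fin d) K,
        Nonempty (RepSpace K d ρ ≃ₗ[Λ] (P ⧸ C)) →
        IsDegeneration b d ρ τ →
        Nonempty ((RepSpace K d τ ⧸ jrad Λ (RepSpace K d τ)) ≃ₗ[Λ]
          (RepSpace K d ρ ⧸ jrad Λ (RepSpace K d ρ))) →
        Nonempty (RepSpace K d τ ≃ₗ[Λ] RepSpace K d ρ)) :
    ∀ f : P →ₗ[Λ] P, C.map f ≤ C := by
  have infK : Infinite K := IsAlgClosed.instInfinite
  have finP : Module.Finite Λ P := Module.Finite.of_restrictScalars_finite K Λ P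
  have artL : IsArtinianRing Λ := IsArtinianRing.of_finite K Λ
  have finA : FiniteDimensional K (Module.End Λ P) := by
    let r : Module.End Λ P →ₗ[K] (P →ₗ[K] P) :=
      { toFun := fun f => f.restrictScalars K
        map_add' := fun _ _ => rfl
        map_smul' := fun _ _ => rfl }
    exact FiniteDimensional.of_injective r (LinearMap.restrictScalars_injective K)
  -- the filtration
  obtain ⟨J, hJdef⟩ : ∃ J : Ideal Λ, J = Ring.jacobson Λ := ⟨_, rfl⟩
  obtain ⟨m, hm⟩ : IsNilpotent J := hJdef ▸ IsSemiprimaryRing.isNilpotent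
  have hJ0 := idl0 J
  have hJ1 := idl1 J
  have hJs := idls J
  have hJs' := idls' J (hJdef ▸ inferInstance)
  let F : ℕ → Set (Module.End Λ P) := fun k => {f | ∀ p, f p ∈ (J ^ k) • (⊤ : Submodule Λ P)}
  have memF : ∀ k f, f ∈ F k ↔ LinearMap.range f ≤ (J ^ k) • (⊤ : Submodule Λ P) := by
    intro k f
    constructor
    · rintro h _ ⟨p, rfl⟩; exact h p
    · intro h p; exact h ⟨p, rfl⟩
  have F0 : ∀ f, f ∈ F 0 := by
    intro f p
    rw [hJ0, Submodule.top_smul]; trivial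
  have Fm : ∀ f ∈ F m, f = 0 := by
    intro f hf
    refine LinearMap.ext fun p => ?_
    have := hf p
    rw [hm] at this
    simpa using this
  have Fl : ∀ k, ∀ n ∈ F 1, ∀ s ∈ F k, n * s ∈ F (k + 1) := by
    intro k n hn s hs p
    have h1 : n (s p) ∈ ((J ^ k) • (⊤ : Submodule Λ P)).map n := ⟨s p, hs p, rfl⟩
    rw [Submodule.map_smul'', Submodule.map_top] at h1
    have h2 := Submodule.smul_mono le_rfl ((memF 1 n).1 hn) h1
    rw [hJ1, ← Submodule.mul_smul, hJs] at h2
    exact h2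
  have Fr : ∀ k, ∀ n ∈ F 1, ∀ s ∈ F k, s * n ∈ F (k + 1) := by
    intro k n hn s hs p
    have h1 : s (n p) ∈ ((J ^ 1) • (⊤ : Submodule Λ P)).map s := ⟨n p, hn p, rfl⟩
    rw [Submodule.map_smul'', Submodule.map_top] at h1
    have h2 := Submodule.smul_mono le_rfl ((memF k s).1 hs) h1
    rw [hJ1, ← Submodule.mul_smul, hJs'] at h2
    exact h2
  have F1 : ∀ f, f ∈ F 1 ↔ ∀ p, f p ∈ jrad Λ P := by
    intro f
    rw [jrad_eq]
    simp only [F, hJ1, ← hJdef]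
    rfl
  have Fc : ∀ f g : Module.End Λ P, f * g - g * f ∈ F 1 := by
    intro f g
    rw [F1]
    intro p
    obtain ⟨t⟩ := hcover
    let Q := jrad Λ P
    have hQ : ∀ f : P →ₗ[Λ] P, Q ≤ Q.comap f := fun f =>
      Submodule.map_le_iff_le_comap.mp (jrad_map_le f)
    let ind : (P →ₗ[Λ] P) → (T →ₗ[Λ] T) := fun f =>
      t.toLinearMap ∘ₗ (Q.mapQ Q f (hQ f)) ∘ₗ t.symm.toLinearMap
    have hind : ∀ f p, ind f (t (Q.mkQ p)) = t (Q.mkQ (f p)) := by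
      intro f p
      simp [ind]
    have := comm_T K hss hsf (ind f) (ind g) (t (Q.mkQ p))
    rw [hind, hind, hind, hind] at this
    have := t.injective this
    rw [← sub_eq_zero, ← map_sub] at this
    exact (Submodule.Quotient.mk_eq_zero Q).1 this
  have Fa : ∀ a, ∀ n ∈ F 1, a * n ∈ F 1 ∧ n * a ∈ F 1 := by
    intro a n hn
    rw [F1] at hn
    rw [F1, F1]
    exact ⟨fun p => jrad_map_le a ⟨n p, hn p, rfl⟩, fun p => hn (a p)⟩
  -- maximal two-sided ideal preserving C
  obtain ⟨I, ⟨hIT, hIC⟩, hmax⟩ := WellFounded.has_min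
    (wellFounded_gt (α := Submodule K (Module.End Λ P)))
    {I | IsTS I ∧ ∀ a ∈ I, ∀ c ∈ C, a c ∈ C}
    ⟨⊥, fun a s hs => by
        rw [Submodule.mem_bot] at hs; subst hs; simp,
      fun a ha c hc => by
        rw [Submodule.mem_bot] at ha; subst ha; simp⟩
  by_cases hne : I = ⊤
  · rintro f _ ⟨c, hc, rfl⟩
    exact hIC f (hne ▸ trivial) c hc
  exfalso
  obtain ⟨x, hxI, hx⟩ := exists_step F F0 m Fm Fl Fr Fc Fa I hIT hne
  -- x * x = μ x + y
  obtain ⟨μ, hμ⟩ := (hx x).1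
  have hxx : ∀ c, x (x c) = (x * x - μ • x) c + μ • x c := by
    intro c; simp
  have smulK : ∀ (D : Submodule Λ P) (k : K) (p : P), p ∈ D → k • p ∈ D := fun D k p hp =>
    D.smul_of_tower_mem k hp
  have hxC : ∀ c ∈ C, x c ∈ C → x (x c) ∈ C := by
    intro c hc hxc
    rw [hxx]
    exact C.add_mem (hIC _ hμ c hc) (smulK C _ _ hxc)
  have hC1I : ∀ a ∈ I, ∀ c ∈ C, a c ∈ C ⊓ C.comap x := fun a ha c hc =>
    ⟨hIC a ha c hc, hIC (x * a) (hIT x a ha).1 c hc⟩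
  have inlim1 : ∀ u ∈ C ⊓ C.comap x, u ∈ limC C x := fun u hu => Submodule.mem_sup_left hu
  have inlim2 : ∀ u ∈ C, x u ∈ limC C x := fun u hu => Submodule.mem_sup_right ⟨u, hu, rfl⟩
  -- I and x preserve the limit
  have limI : ∀ a ∈ I, ∀ v ∈ limC C x, a v ∈ limC C x := by
    intro a ha v hv
    obtain ⟨u, hu, c, hc, rfl⟩ := (mem_limC C x v).1 hv
    rw [map_add]
    exact add_mem (inlim1 _ (hC1I a ha u hu.1))
      (inlim1 _ (hC1I (a * x) (hIT x a ha).2 c hc))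
  have limx : ∀ v ∈ limC C x, x v ∈ limC C x := by
    intro v hv
    obtain ⟨u, hu, c, hc, rfl⟩ := (mem_limC C x v).1 hv
    rw [map_add, hxx]
    exact add_mem (inlim2 u hu.1) (add_mem (inlim1 _ (hC1I _ hμ c hc)) (smulK _ _ _ (inlim2 c hc)))
  have limJ : limC C x ≤ jrad Λ P := by
    refine sup_le (inf_le_left.trans hC) ?_
    exact (Submodule.map_mono hC).trans (jrad_map_le x)
  -- the degeneration
  have hd0 : finrank K (P ⧸ limC C x) = d := (limC_finrank C x hxC).trans hd
  obtain ⟨ρ, ⟨eρ⟩⟩ := exists_rep (Λ := Λ) (P ⧸ C) d hd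
  obtain ⟨τ, ⟨eτ⟩⟩ := exists_rep (Λ := Λ) (P ⧸ limC C x) d hd0
  have hdeg := deg_main b d ρ τ C x hxC eρ eτ
  obtain ⟨t1⟩ := top_equiv eρ
  obtain ⟨t2⟩ := top_quot C hC
  obtain ⟨t3⟩ := top_equiv eτ
  obtain ⟨t4⟩ := top_quot (limC C x) limJ
  obtain ⟨i0⟩ := H ρ τ ⟨eρ⟩ hdeg ⟨(t3.trans t4).trans (t1.trans t2).symm⟩
  let i : (P ⧸ limC C x) ≃ₗ[Λ] (P ⧸ C) := eτ.symm.trans (i0.trans eρ)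
  obtain ⟨g, hg, gs⟩ := cover_lift (P := P) C hC (i.toLinearMap ∘ₗ (limC C x).mkQ)
    (i.surjective.comp (limC C x).mkQ_surjective)
  have gi : Function.Injective g := by
    have : Function.Injective (g.restrictScalars K) := LinearMap.injective_iff_surjective.mpr gs
    exact this
  have gmem : ∀ p, g p ∈ C ↔ p ∈ limC C x := by
    intro p
    have h1 : C.mkQ (g p) = i ((limC C x).mkQ p) := LinearMap.congr_fun hg p
    rw [← Submodule.Quotient.mk_eq_zero C, ← Submodule.Quotient.mk_eq_zero (limC C x),
      ← Submodule.mkQ_apply, ← Submodule.mkQ_apply, h1, LinearEquiv.map_eq_zero_iff]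
  let G : P ≃ₗ[Λ] P := LinearEquiv.ofBijective g ⟨gi, gs⟩
  let gA : Module.End Λ P := G.toLinearMap
  let gB : Module.End Λ P := G.symm.toLinearMap
  -- the bigger ideal
  let I' : Submodule K (Module.End Λ P) := I ⊔ Submodule.span K {x}
  have memI' : ∀ a, a ∈ I' ↔ ∃ y ∈ I, ∃ k : K, y + k • x = a := by
    intro a
    simp only [I', Submodule.mem_sup, Submodule.mem_span_singleton]
    constructor
    · rintro ⟨y, hy, _, ⟨k, rfl⟩, rfl⟩; exact ⟨y, hy, k, rfl⟩
    · rintro ⟨y, hy, k, rfl⟩; exact ⟨y, hy, _, ⟨k, rfl⟩, rfl⟩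
  have hI'T : IsTS I' := by
    intro a s hs
    obtain ⟨y, hy, k, rfl⟩ := (memI' s).1 hs
    obtain ⟨⟨α, hα⟩, β, hβ⟩ := hx a
    constructor
    · refine (memI' _).2 ⟨a * y + k • (a * x - α • x),
        I.add_mem (hIT a y hy).1 (I.smul_mem _ hα), k * α, ?_⟩
      rw [mul_add, mul_smul_comm, smul_sub, mul_smul]; abel
    · refine (memI' _).2 ⟨y * a + k • (x * a - β • x),
        I.add_mem (hIT a y hy).2 (I.smul_mem _ hβ), k * β, ?_⟩
      rw [add_mul, smul_mul_assoc, smul_sub, mul_smul]; abel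
  have limI' : ∀ a ∈ I', ∀ v ∈ limC C x, a v ∈ limC C x := by
    intro a ha v hv
    obtain ⟨y, hy, k, rfl⟩ := (memI' a).1 ha
    exact add_mem (limI y hy v hv) (smulK _ _ _ (limx v hv))
  refine hmax I' ⟨hI'T, fun a ha c hc => ?_⟩ ?_
  · have h1 : gB * a * gA ∈ I' := (hI'T gA _ (hI'T gB a ha).1).2
    obtain ⟨p, rfl⟩ := gs c
    have h2 := limI' _ h1 p ((gmem p).1 hc)
    have h3 := (gmem _).2 h2
    have h4 : g ((gB * a * gA) p) = a (g p) := G.apply_symm_apply (a (g p))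
    rwa [h4] at h3
  · refine lt_of_le_of_ne le_sup_left ?_
    intro e
    apply hxI
    rw [e]
    exact Submodule.mem_sup_right (Submodule.mem_span_singleton_self x)

/-- Let `T` be a squarefree semisimple `Λ`-module with projective cover `P`,
and `C ⊆ JP` a submodule with `dim_K (P/C) = d`.  Then `M = P/C` has no proper top-stable
degeneration if and only if `C` is invariant under every `Λ`-endomorphism of `P`. -/
theorem stmt1 {K Λ ι : Type} [Field K] [IsAlgClosed K] [Ring Λ] [Algebra K Λ]
    [FiniteDimensional K Λ] [Fintype ι] (b : Basis ι K Λ)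
    (T : Type) [AddCommGroup T] [Module Λ T] [Module K T] [IsScalarTower K Λ T]
    [FiniteDimensional K T]
    (P : Type) [AddCommGroup P] [Module Λ P] [Module K P] [IsScalarTower K Λ P]
    [FiniteDimensional K P]
    -- `T` is semisimple and squarefree
    (hss : IsSemisimpleModule Λ T)
    (hsf : ∀ S S' : Submodule Λ T, IsSimpleModule Λ ↥S → IsSimpleModule Λ ↥S' →
        Nonempty (↥S ≃ₗ[Λ] ↥S') → S = S')
    -- `P` is a projective cover of `T`
    (hproj : Module.Projective Λ P)
    (hcover : Nonempty ((P ⧸ jrad Λ P) ≃ₗ[Λ] T))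
    (C : Submodule Λ P) (hC : C ≤ jrad Λ P)
    (d : ℕ) (hd : finrank K (P ⧸ C) = d) :
    -- (i) `M = P/C` has no proper top-stable degeneration:
    (∀ ρ τ : Λ →ₐ[K] Matrix (Fin d) (Fin d) K,
        Nonempty (RepSpace K d ρ ≃ₗ[Λ] (P ⧸ C)) →
        IsDegeneration b d ρ τ →
        Nonempty ((RepSpace K d τ ⧸ jrad Λ (RepSpace K d τ)) ≃ₗ[Λ]
          (RepSpace K d ρ ⧸ jrad Λ (RepSpace K d ρ))) →
        Nonempty (RepSpace K d τ ≃ₗ[Λ] RepSpace K d ρ))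
    ↔
    -- (ii) `C` is invariant under every `Λ`-endomorphism of `P`:
    (∀ f : P →ₗ[Λ] P, C.map f ≤ C) := by
  exact ⟨dir1 b T P hss hsf hproj hcover C hC d hd,
    fun hinv ρ τ hρ hdeg htop => dir2 b P hproj C hC d hd hinv ρ τ hρ hdeg htop⟩
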